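/- Let f_n in C[u] be the Fibonacci polynomials, defined by f_0 = 0, f_1 = 1, and f_n = u*f_{n-1} - f_{n-2}, and for a natural number k let h_k(x,z) = 2*z*(f_{k+2}(z) - f_{k+1}(z)) - x^2*(f_{k+1}(z) - f_k(z)) in C[x,z]. Then for every k ≥ 0 there is no point (x,z) in C^2 at which h_k and both of its partial derivatives with respect to x and z vanish simultaneously; that is, the affine plane curve h_k = 0 has no singular points. -/

import Mathlib

/-- The Fibonacci polynomials `f₀ = 0`, `f₁ = 1`, `fₙ = u·fₙ₋₁ - fₙ₋₂`. -/
noncomputable def fibP : ℕ → Polynomial ℂ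
  | 0 => 0
  | 1 => 1
  | (n + 2) => Polynomial.X * fibP (n + 1) - fibP n

/-- The Fibonacci polynomial `fₘ` with variable the second variable `z` of `ℂ[x,z]`. -/
noncomputable def fibZ (m : ℕ) : MvPolynomial (Fin 2) ℂ :=
  Polynomial.aeval (MvPolynomial.X 1) (fibP m)

/-- The polynomial `h_k(x,z) = 2z(f_{k+2}(z) - f_{k+1}(z)) - x²(f_{k+1}(z) - f_k(z))`. -/
noncomputable def hPoly (k : ℕ) : MvPolynomial (Fin 2) ℂ :=
  2 * MvPolynomial.X 1 * (fibZ (k + 2) - fibZ (k + 1)) -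
    (MvPolynomial.X 0) ^ 2 * (fibZ (k + 1) - fibZ k)

open Polynomial in
lemma fibP_add_two (n : ℕ) : fibP (n + 2) = X * fibP (n + 1) - fibP n := by
  rw [fibP]

open Polynomial in
/-- The Cassini identity for the Fibonacci polynomials. -/
lemma fibP_cassini (n : ℕ) :
    fibP (n + 1) ^ 2 - X * fibP n * fibP (n + 1) + fibP n ^ 2 = 1 := by
  induction n with
  | zero => simp [fibP]
  | succ n ih =>
    rw [fibP_add_two]
    linear_combination ih

/-- Consecutive Fibonacci polynomials have no common root. -/
lemma fibP_eval_succ_ne_zero {n : ℕ} {z : ℂ} (h : (fibP n).eval z = 0) :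
    (fibP (n + 1)).eval z ≠ 0 := by
  intro h'
  simpa [h, h'] using congrArg (Polynomial.eval z) (fibP_cassini n)

lemma fibP_eval_zero_sub_sq (n : ℕ) :
    ((fibP (n + 1)).eval 0 - (fibP n).eval 0) ^ 2 = 1 := by
  induction n using Nat.twoStepInduction with
  | zero => simp [fibP]
  | one => simp [fibP]
  | more n ih _ =>
    simp only [fibP_add_two n, fibP_add_two (n + 1), Polynomial.eval_sub, Polynomial.eval_mul,
      Polynomial.eval_X]
    linear_combination ih

open Polynomial in
/-- First-order differential system satisfied by `fₙ₊₁ - fₙ` and `fₙ₊₁ + fₙ`. -/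
lemma fibP_derivative_system (n : ℕ) :
    2 * (X + 2) * derivative (fibP (n + 1) - fibP n) =
        (2 * (n : ℂ[X]) + 1) * (fibP (n + 1) + fibP n) - (fibP (n + 1) - fibP n) ∧
      2 * (X - 2) * derivative (fibP (n + 1) + fibP n) =
        (2 * (n : ℂ[X]) + 1) * (fibP (n + 1) - fibP n) - (fibP (n + 1) + fibP n) := by
  induction n with
  | zero => simp [fibP]
  | succ n ih =>
    obtain ⟨ihSub, ihAdd⟩ := ih
    have two_ne : (2 : ℂ[X]) ≠ 0 := two_ne_zero
    simp only [fibP_add_two, derivative_sub, derivative_add, derivative_mul, derivative_X]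
      at ihSub ihAdd ⊢
    push_cast
    constructor <;> apply mul_left_cancel₀ two_ne
    · linear_combination X * ihSub + (X + 2) * ihAdd
    · linear_combination (X - 2) * ihSub + X * ihAdd

/-- The polynomial `fₙ₊₁ - fₙ` has no multiple root. -/
lemma fibP_sub_derivative_eval_ne_zero {n : ℕ} {z : ℂ}
    (h : (fibP (n + 1)).eval z - (fibP n).eval z = 0) :
    (fibP (n + 1)).derivative.eval z - (fibP n).derivative.eval z ≠ 0 := by
  intro hd
  have e := congrArg (Polynomial.eval z) (fibP_derivative_system n).1
  simp only [Polynomial.eval_mul, Polynomial.eval_add, Polynomial.eval_sub,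
    Polynomial.derivative_sub, hd, h, Polynomial.eval_natCast, Polynomial.eval_ofNat,
    Polynomial.eval_one, mul_zero, sub_zero] at e
  have hn : (2 * (n : ℂ) + 1) ≠ 0 := by exact_mod_cast (2 * n).succ_ne_zero
  have hs := (mul_eq_zero.mp e.symm).resolve_left hn
  have h0 : (fibP n).eval z = 0 := by linear_combination (hs - h) / 2
  exact fibP_eval_succ_ne_zero h0 (by linear_combination (hs + h) / 2)

lemma MvPolynomial.eval_aeval_X {σ R : Type*} [CommSemiring R] (p : σ → R) (i : σ)
    (q : Polynomial R) :
    MvPolynomial.eval p (Polynomial.aeval (MvPolynomial.X i) q) = q.eval (p i) := by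
  rw [← MvPolynomial.coe_aeval_eq_eval, RingHom.coe_coe, ← Polynomial.aeval_algHom_apply,
    MvPolynomial.aeval_X, Polynomial.coe_aeval_eq_eval]

lemma eval_fibZ (p : Fin 2 → ℂ) (m : ℕ) :
    MvPolynomial.eval p (fibZ m) = (fibP m).eval (p 1) :=
  MvPolynomial.eval_aeval_X p 1 (fibP m)

lemma pderiv_fibZ (i : Fin 2) (m : ℕ) :
    MvPolynomial.pderiv i (fibZ m) =
      Polynomial.aeval (MvPolynomial.X 1) (fibP m).derivative *
        MvPolynomial.pderiv i (MvPolynomial.X 1) := by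
  rw [fibZ, Derivation.map_aeval, smul_eq_mul]

lemma eval_pderiv_zero_fibZ (p : Fin 2 → ℂ) (m : ℕ) :
    MvPolynomial.eval p (MvPolynomial.pderiv 0 (fibZ m)) = 0 := by
  simp [pderiv_fibZ]

lemma eval_pderiv_one_fibZ (p : Fin 2 → ℂ) (m : ℕ) :
    MvPolynomial.eval p (MvPolynomial.pderiv 1 (fibZ m)) = (fibP m).derivative.eval (p 1) := by
  rw [pderiv_fibZ, MvPolynomial.pderiv_X_self, mul_one, MvPolynomial.eval_aeval_X]

/-- Lemma 5.12 (smoothness): for every `k ≥ 0`, the affine plane curve `h_k = 0`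
has no singular points. -/
theorem hPoly_no_singular_point (k : ℕ) :
    ¬ ∃ p : Fin 2 → ℂ,
      MvPolynomial.eval p (hPoly k) = 0 ∧
      MvPolynomial.eval p (MvPolynomial.pderiv 0 (hPoly k)) = 0 ∧
      MvPolynomial.eval p (MvPolynomial.pderiv 1 (hPoly k)) = 0 := by
  rintro ⟨p, h, hx, hz⟩
  have two_eq : (2 : MvPolynomial (Fin 2) ℂ) = MvPolynomial.C 2 := rfl
  simp only [hPoly, two_eq, map_sub, map_mul, map_pow, Derivation.leibniz, Derivation.leibniz_pow,
    smul_eq_mul, nsmul_eq_mul, map_add, MvPolynomial.eval_X, MvPolynomial.eval_C, eval_fibZ,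
    eval_pderiv_zero_fibZ, eval_pderiv_one_fibZ, MvPolynomial.pderiv_C,
    MvPolynomial.pderiv_X_self, MvPolynomial.pderiv_X_of_ne (R := ℂ) (Fin.zero_ne_one (n := 0)),
    MvPolynomial.pderiv_X_of_ne (R := ℂ) (Fin.zero_ne_one (n := 0)).symm,
    map_zero, map_one, Nat.cast_ofNat] at h hx hz
  have zero_ne (m : ℕ) (hm : (fibP (m + 1)).eval (p 1) - (fibP m).eval (p 1) = 0) :
      p 1 ≠ 0 := by
    intro h0
    rw [h0] at hm
    simpa [hm] using fibP_eval_zero_sub_sq m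
  have hx' : p 0 * ((fibP (k + 1)).eval (p 1) - (fibP k).eval (p 1)) = 0 := by
    linear_combination -hx / 2
  rcases mul_eq_zero.mp hx' with h0 | hg
  · rw [h0] at h hz
    have h' : p 1 * ((fibP (k + 2)).eval (p 1) - (fibP (k + 1)).eval (p 1)) = 0 := by
      linear_combination h / 2
    have hg : (fibP (k + 2)).eval (p 1) - (fibP (k + 1)).eval (p 1) = 0 := by
      rcases mul_eq_zero.mp h' with hp | hg
      · rw [hp] at hz ⊢
        linear_combination hz / 2
      · exact hg
    have hd : p 1 * ((fibP (k + 2)).derivative.eval (p 1) -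
        (fibP (k + 1)).derivative.eval (p 1)) = 0 := by
      linear_combination hz / 2 - hg
    exact fibP_sub_derivative_eval_ne_zero hg
      ((mul_eq_zero.mp hd).resolve_left (zero_ne (k + 1) hg))
  · have hp := zero_ne k hg
    have h' : p 1 * ((fibP (k + 2)).eval (p 1) - (fibP (k + 1)).eval (p 1)) = 0 := by
      linear_combination h / 2 + p 0 ^ 2 / 2 * hg
    have hg' := (mul_eq_zero.mp h').resolve_left hp
    have hrec := congrArg (Polynomial.eval (p 1)) (fibP_add_two k)
    simp only [Polynomial.eval_sub, Polynomial.eval_mul, Polynomial.eval_X] at hrec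
    have hcas := congrArg (Polynomial.eval (p 1)) (fibP_cassini k)
    simp only [Polynomial.eval_sub, Polynomial.eval_mul, Polynomial.eval_X, Polynomial.eval_add,
      Polynomial.eval_pow, Polynomial.eval_one] at hcas
    exact one_ne_zero (α := ℂ) (by
      linear_combination -hcas + (fibP (k + 1)).eval (p 1) * hg - (fibP k).eval (p 1) * hg' +
        (fibP k).eval (p 1) * hrec)
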